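/- arXiv:2303.07918 — 5 statements merged into one kernel-verified Lean document; each statement's English description precedes it below -/
import Mathlib

section
/- For any three s-dimensional subspaces U, V, W of ℝ^d the maximal principal angle satisfies the triangle inequality ∠(U,W) ≤ ∠(U,V) + ∠(V,W); consequently d₁(V,W) := ∠(V,W) defines a metric on the Grassmannian G(s,d) of all s-dimensional subspaces of ℝ^d. -/
open scoped Matrix RealInnerProductSpace
open Module

/-- The maximal principal angle `∠(V,W)` between two subspaces of `ℝ^d`,
via the max-min characterization
`∠(V,W) = arccos( min_{v∈V,‖v‖=1} max_{w∈W,‖w‖=1} vᵀw )`. -/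
noncomputable def maxAngle {d : ℕ} (V W : Submodule ℝ (EuclideanSpace ℝ (Fin d))) : ℝ :=
  Real.arccos (sInf {r : ℝ | ∃ v ∈ V, ‖v‖ = 1 ∧
    r = sSup {c : ℝ | ∃ w ∈ W, ‖w‖ = 1 ∧ c = ⟪v, w⟫}})

section helpers

variable {d : ℕ}

lemma exists_unit_of_finrank {s : ℕ} (hs : 1 ≤ s)
    {W : Submodule ℝ (EuclideanSpace ℝ (Fin d))} (hW : finrank ℝ W = s) :
    ∃ w ∈ W, ‖w‖ = 1 := by
  have hne : W ≠ ⊥ := by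
    rintro rfl
    simp at hW
    omega
  obtain ⟨x, hx, hx0⟩ := Submodule.exists_mem_ne_zero_of_ne_bot hne
  exact ⟨‖x‖⁻¹ • x, W.smul_mem _ hx, by simpa using norm_smul_inv_norm (𝕜 := ℝ) hx0⟩

lemma exists_max {W : Submodule ℝ (EuclideanSpace ℝ (Fin d))} (hW : ∃ w ∈ W, ‖w‖ = 1)
    (v : EuclideanSpace ℝ (Fin d)) :
    ∃ w ∈ W, ‖w‖ = 1 ∧ IsGreatest {c : ℝ | ∃ w ∈ W, ‖w‖ = 1 ∧ c = ⟪v, w⟫} ⟪v, w⟫ := by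
  have hc : IsCompact ((W : Set (EuclideanSpace ℝ (Fin d))) ∩ Metric.sphere 0 1) :=
    (isCompact_sphere 0 1).inter_left W.closed_of_finiteDimensional
  obtain ⟨w₀, hw₀, hn₀⟩ := hW
  obtain ⟨w, ⟨hw, hwn⟩, hmax⟩ := hc.exists_isMaxOn ⟨w₀, hw₀, by simpa using hn₀⟩
    (f := fun w => ⟪v, w⟫) (by fun_prop)
  have hwn : ‖w‖ = 1 := by simpa using hwn
  refine ⟨w, hw, hwn, ⟨w, hw, hwn, rfl⟩, ?_⟩
  rintro c ⟨x, hx, hxn, rfl⟩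
  exact hmax ⟨hx, by simpa using hxn⟩

lemma angle_unit {v w : EuclideanSpace ℝ (Fin d)} (hv : ‖v‖ = 1) (hw : ‖w‖ = 1) :
    InnerProductGeometry.angle v w = Real.arccos ⟪v, w⟫ := by
  simp [InnerProductGeometry.angle, hv, hw]

lemma bdd_aux {V W : Submodule ℝ (EuclideanSpace ℝ (Fin d))} (hW : ∃ w ∈ W, ‖w‖ = 1) :
    ∀ r ∈ {r : ℝ | ∃ v ∈ V, ‖v‖ = 1 ∧
      r = sSup {c : ℝ | ∃ w ∈ W, ‖w‖ = 1 ∧ c = ⟪v, w⟫}}, 0 ≤ r := by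
  rintro r ⟨v, hv, hvn, rfl⟩
  obtain ⟨w, hw, hwn, hg⟩ := exists_max hW v
  rw [hg.csSup_eq]
  have := hg.2 ⟨-w, W.neg_mem hw, by simpa using hwn, rfl⟩
  rw [inner_neg_right] at this
  linarith

lemma maxAngle_exists {V W : Submodule ℝ (EuclideanSpace ℝ (Fin d))}
    (hW : ∃ w ∈ W, ‖w‖ = 1) {v : EuclideanSpace ℝ (Fin d)} (hv : v ∈ V) (hvn : ‖v‖ = 1) :
    ∃ w ∈ W, ‖w‖ = 1 ∧ InnerProductGeometry.angle v w ≤ maxAngle V W := by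
  obtain ⟨w, hw, hwn, hg⟩ := exists_max hW v
  refine ⟨w, hw, hwn, ?_⟩
  rw [angle_unit hvn hwn, maxAngle]
  apply Real.arccos_le_arccos
  exact csInf_le ⟨0, bdd_aux hW⟩ ⟨v, hv, hvn, hg.csSup_eq.symm⟩

lemma maxAngle_le {V W : Submodule ℝ (EuclideanSpace ℝ (Fin d))}
    (hV : ∃ v ∈ V, ‖v‖ = 1) (hW : ∃ w ∈ W, ‖w‖ = 1) {θ : ℝ}
    (h : ∀ v ∈ V, ‖v‖ = 1 → ∃ w ∈ W, ‖w‖ = 1 ∧ InnerProductGeometry.angle v w ≤ θ) :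
    maxAngle V W ≤ θ := by
  have h0 : 0 ≤ θ := by
    obtain ⟨v, hv, hvn⟩ := hV
    obtain ⟨w, -, -, h⟩ := h v hv hvn
    exact (InnerProductGeometry.angle_nonneg v w).trans h
  by_cases hpi : Real.pi < θ
  · exact (Real.arccos_le_pi _).trans hpi.le
  push Not at hpi
  rw [← Real.arccos_cos h0 hpi, maxAngle]
  apply Real.arccos_le_arccos
  obtain ⟨v, hv, hvn⟩ := hV
  refine le_csInf ⟨_, v, hv, hvn, rfl⟩ ?_
  rintro r ⟨v, hv, hvn, rfl⟩
  obtain ⟨w, hw, hwn, hle⟩ := h v hv hvn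
  obtain ⟨w', hw', hwn', hg⟩ := exists_max hW v
  rw [hg.csSup_eq]
  refine le_trans ?_ (hg.2 ⟨w, hw, hwn, rfl⟩)
  have := Real.cos_le_cos_of_nonneg_of_le_pi (InnerProductGeometry.angle_nonneg v w) hpi hle
  rw [InnerProductGeometry.cos_angle, hvn, hwn] at this
  simpa using this

lemma maxAngle_nonneg (V W : Submodule ℝ (EuclideanSpace ℝ (Fin d))) : 0 ≤ maxAngle V W :=
  Real.arccos_nonneg _

lemma maxAngle_symm_le {s : ℕ} (hs : 1 ≤ s) {V W : Submodule ℝ (EuclideanSpace ℝ (Fin d))}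
    (hV : finrank ℝ V = s) (hW : finrank ℝ W = s) : maxAngle W V ≤ maxAngle V W := by
  have hV1 := exists_unit_of_finrank hs hV
  have hW1 := exists_unit_of_finrank hs hW
  apply maxAngle_le hW1 hV1
  intro w hw hwn
  by_cases hθ : Real.pi / 2 ≤ maxAngle V W
  · obtain ⟨v, hv, hvn⟩ := hV1
    rcases le_total 0 ⟪w, v⟫ with h | h
    · refine ⟨v, hv, hvn, le_trans ?_ hθ⟩
      rw [angle_unit hwn hvn]
      exact Real.arccos_le_pi_div_two.2 h
    · refine ⟨-v, V.neg_mem hv, by simpa using hvn, le_trans ?_ hθ⟩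
      rw [angle_unit hwn (by simpa using hvn), inner_neg_right]
      exact Real.arccos_le_pi_div_two.2 (by linarith)
  push Not at hθ
  set θ := maxAngle V W with hdef
  have h0 : 0 ≤ θ := maxAngle_nonneg V W
  have hcos : 0 < Real.cos θ := Real.cos_pos_of_mem_Ioo ⟨by linarith [Real.pi_pos], hθ⟩
  -- the orthogonal projection does not shrink unit vectors of V by more than cos θ
  have key : ∀ v ∈ V, ‖v‖ = 1 → Real.cos θ ≤ ‖W.orthogonalProjectionOnto v‖ := by
    intro v hv hvn
    obtain ⟨x, hx, hxn, hle⟩ := maxAngle_exists hW1 hv hvn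
    have h1 := Real.cos_le_cos_of_nonneg_of_le_pi (InnerProductGeometry.angle_nonneg v x)
      (by linarith [Real.pi_pos] : θ ≤ Real.pi) hle
    rw [InnerProductGeometry.cos_angle, hvn, hxn, mul_one, div_one] at h1
    have h2 : ⟪v, x⟫ = ⟪W.orthogonalProjectionOnto v, (⟨x, hx⟩ : W)⟫ := by
      rw [Submodule.inner_orthogonalProjectionOnto_eq_of_mem_right]
    rw [h2] at h1
    refine h1.trans ((real_inner_le_norm _ _).trans ?_)
    simp [hxn]
  have key2 : ∀ v ∈ V, Real.cos θ * ‖v‖ ≤ ‖W.orthogonalProjectionOnto v‖ := by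
    intro v hv
    by_cases hv0 : v = 0
    · simp [hv0]
    have hn : 0 < ‖v‖ := norm_pos_iff.2 hv0
    have := key (‖v‖⁻¹ • v) (V.smul_mem _ hv) (by simpa using norm_smul_inv_norm (𝕜 := ℝ) hv0)
    rw [map_smul, norm_smul, norm_inv, norm_norm, inv_mul_eq_div, le_div_iff₀ hn] at this
    exact this
  let f : V →ₗ[ℝ] W := W.orthogonalProjectionOnto.toLinearMap ∘ₗ V.subtype
  have hinj : Function.Injective f := by
    rw [← LinearMap.ker_eq_bot, LinearMap.ker_eq_bot']
    intro v hv
    have h1 := key2 v v.2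
    have h2 : W.orthogonalProjectionOnto (v : EuclideanSpace ℝ (Fin d)) = 0 := hv
    rw [h2, norm_zero] at h1
    have : ‖(v : EuclideanSpace ℝ (Fin d))‖ = 0 := by
      nlinarith [norm_nonneg (v : EuclideanSpace ℝ (Fin d))]
    simpa using this
  have hsurj : Function.Surjective f :=
    (LinearMap.injective_iff_surjective_of_finrank_eq_finrank (hV.trans hW.symm)).1 hinj
  obtain ⟨v, hv⟩ := hsurj ⟨w, hw⟩
  have hv' : W.orthogonalProjectionOnto (v : EuclideanSpace ℝ (Fin d)) = ⟨w, hw⟩ := hv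
  have hin : ⟪w, (v : EuclideanSpace ℝ (Fin d))⟫ = 1 := by
    have := Submodule.inner_orthogonalProjectionOnto_eq_of_mem_left (K := W) ⟨w, hw⟩
      (v : EuclideanSpace ℝ (Fin d))
    rw [hv', real_inner_self_eq_norm_sq] at this
    simp [hwn] at this
    exact this.symm
  have hv0 : (v : EuclideanSpace ℝ (Fin d)) ≠ 0 := by
    intro h
    simp [h] at hin
  have hn : 0 < ‖(v : EuclideanSpace ℝ (Fin d))‖ := norm_pos_iff.2 hv0
  have hle := key2 v v.2
  rw [hv'] at hle
  have hle : Real.cos θ * ‖(v : EuclideanSpace ℝ (Fin d))‖ ≤ 1 := by simpa [hwn] using hle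
  refine ⟨‖(v : EuclideanSpace ℝ (Fin d))‖⁻¹ • v, V.smul_mem _ v.2,
    by simpa using norm_smul_inv_norm (𝕜 := ℝ) hv0, ?_⟩
  rw [angle_unit hwn (by simpa using norm_smul_inv_norm (𝕜 := ℝ) hv0), inner_smul_right, hin,
    ← Real.arccos_cos h0 (by linarith [Real.pi_pos] : θ ≤ Real.pi)]
  apply Real.arccos_le_arccos
  rw [mul_one, le_inv_comm₀ hcos hn, ← one_div, le_div_iff₀ hcos]
  linarith

end helpers

/-- For any three `s`-dimensional subspaces `U, V, W` of `ℝ^d` the maximal principal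
angle satisfies the triangle inequality `∠(U,W) ≤ ∠(U,V) + ∠(V,W)`; consequently
`d₁(V,W) := ∠(V,W)` defines a metric on the Grassmannian `G(s,d)`. -/
theorem stmt0 (d s : ℕ) (hs : 1 ≤ s) (hsd : s ≤ d) :
    (∀ U V W : Submodule ℝ (EuclideanSpace ℝ (Fin d)),
      finrank ℝ U = s → finrank ℝ V = s → finrank ℝ W = s →
      maxAngle U W ≤ maxAngle U V + maxAngle V W) ∧
    (∀ V W : Submodule ℝ (EuclideanSpace ℝ (Fin d)),
      finrank ℝ V = s → finrank ℝ W = s → 0 ≤ maxAngle V W) ∧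
    (∀ V W : Submodule ℝ (EuclideanSpace ℝ (Fin d)),
      finrank ℝ V = s → finrank ℝ W = s → maxAngle V W = maxAngle W V) ∧
    (∀ V W : Submodule ℝ (EuclideanSpace ℝ (Fin d)),
      finrank ℝ V = s → finrank ℝ W = s → (maxAngle V W = 0 ↔ V = W)) := by
  refine ⟨?_, fun V W _ _ => maxAngle_nonneg V W, fun V W hV hW =>
    le_antisymm (maxAngle_symm_le hs hW hV) (maxAngle_symm_le hs hV hW), ?_⟩
  · intro U V W hU hV hW
    have hU1 := exists_unit_of_finrank hs hU
    have hV1 := exists_unit_of_finrank hs hV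
    have hW1 := exists_unit_of_finrank hs hW
    apply maxAngle_le hU1 hW1
    intro u hu hun
    obtain ⟨v, hv, hvn, h1⟩ := maxAngle_exists hV1 hu hun
    obtain ⟨w, hw, hwn, h2⟩ := maxAngle_exists hW1 hv hvn
    exact ⟨w, hw, hwn, (InnerProductGeometry.angle_le_angle_add_angle u v w).trans
      (add_le_add h1 h2)⟩
  · intro V W hV hW
    have hV1 := exists_unit_of_finrank hs hV
    have hW1 := exists_unit_of_finrank hs hW
    constructor
    · intro h
      apply Submodule.eq_of_le_of_finrank_eq _ (hV.trans hW.symm)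
      intro v hv
      by_cases hv0 : v = 0
      · simp [hv0]
      have hn : ‖‖v‖⁻¹ • v‖ = 1 := by simpa using norm_smul_inv_norm (𝕜 := ℝ) hv0
      obtain ⟨w, hw, hwn, hle⟩ := maxAngle_exists hW1 (V.smul_mem (‖v‖⁻¹) hv) hn
      rw [h, angle_unit hn hwn] at hle
      have h1 := Real.arccos_eq_zero.1 (le_antisymm hle (Real.arccos_nonneg _))
      have h2 := real_inner_le_norm (‖v‖⁻¹ • v) w
      rw [hn, hwn, mul_one] at h2
      have h3 := (inner_eq_one_iff_of_norm_eq_one (𝕜 := ℝ) hn hwn).1 (le_antisymm h2 h1)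
      have h4 : ‖v‖⁻¹ • v ∈ W := h3 ▸ hw
      exact (W.smul_mem_iff (inv_ne_zero (norm_ne_zero_iff.2 hv0))).1 h4
    · rintro rfl
      refine le_antisymm (maxAngle_le hV1 hV1 fun v hv hvn => ⟨v, hv, hvn, ?_⟩)
        (maxAngle_nonneg _ _)
      rw [angle_unit hvn hvn, real_inner_self_eq_norm_sq, hvn]
      simp
end

section
/- Let P₁, P₂ ∈ ℝ^{d×s} have orthonormal columns and let P₁ᵀP₂ = YΣZᵀ be a singular value decomposition with singular values σ₁ ≥ … ≥ σ_s. Then min over orthogonal Q₁, Q₂ ∈ O(s) of the spectral norm ‖P₁Q₁ − P₂Q₂‖ equals √(2(1−σ_s)) = 2 sin(φ_s/2), where φ_s is the maximal principal angle between range(P₁) and range(P₂), and the minimum is attained at Q₁ = Y, Q₂ = Z. Moreover, d_σ(V₁,V₂) := 2 sin(∠(V₁,V₂)/2) defines a metric on the Grassmannian G(s,d). -/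
open scoped Matrix RealInnerProductSpace
open Module

/-- The spectral norm of a rectangular real matrix. -/
noncomputable def sNorm {m n : ℕ} (A : Matrix (Fin m) (Fin n) ℝ) : ℝ :=
  ‖LinearMap.toContinuousLinearMap (Matrix.toEuclideanLin A)‖

abbrev EE (d : ℕ) := EuclideanSpace ℝ (Fin d)

/-- cosine of the maximal angle -/
noncomputable def cc {d : ℕ} (V W : Submodule ℝ (EE d)) : ℝ :=
  sInf {r : ℝ | ∃ v ∈ V, ‖v‖ = 1 ∧ r = sSup {c : ℝ | ∃ w ∈ W, ‖w‖ = 1 ∧ c = ⟪v, w⟫}}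

lemma exists_unit {d : ℕ} (V : Submodule ℝ (EE d)) (h : 1 ≤ finrank ℝ V) :
    ∃ v ∈ V, ‖v‖ = 1 := by
  have : Nontrivial V := Module.nontrivial_of_finrank_pos (R := ℝ) (by omega)
  obtain ⟨v, hv⟩ := exists_norm_eq V (zero_le_one (α := ℝ))
  exact ⟨v, v.2, by simpa using hv⟩

lemma inner_le_one {d : ℕ} (v w : EE d) (hv : ‖v‖ = 1) (hw : ‖w‖ = 1) : ⟪v, w⟫ ≤ 1 := by
  have := real_inner_le_norm v w
  simpa [hv, hw] using this

lemma bdd_in {d : ℕ} (W : Submodule ℝ (EE d)) (v : EE d) (hv : ‖v‖ = 1) :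
    BddAbove {c : ℝ | ∃ w ∈ W, ‖w‖ = 1 ∧ c = ⟪v, w⟫} := by
  refine ⟨1, ?_⟩
  rintro c ⟨w, -, hw, rfl⟩
  exact inner_le_one v w hv hw

lemma sup_nonneg {d : ℕ} (W : Submodule ℝ (EE d)) (hW : 1 ≤ finrank ℝ W) (v : EE d)
    (hv : ‖v‖ = 1) : 0 ≤ sSup {c : ℝ | ∃ w ∈ W, ‖w‖ = 1 ∧ c = ⟪v, w⟫} := by
  obtain ⟨w, hw, hw1⟩ := exists_unit W hW
  have h1 := le_csSup (bdd_in W v hv) ⟨w, hw, hw1, rfl⟩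
  have h2 := le_csSup (bdd_in W v hv) ⟨-w, W.neg_mem hw, by simpa using hw1, rfl⟩
  rw [inner_neg_right] at h2
  linarith

lemma bdd_out {d : ℕ} (V W : Submodule ℝ (EE d)) (hW : 1 ≤ finrank ℝ W) :
    BddBelow {r : ℝ | ∃ v ∈ V, ‖v‖ = 1 ∧
      r = sSup {c : ℝ | ∃ w ∈ W, ‖w‖ = 1 ∧ c = ⟪v, w⟫}} := by
  refine ⟨0, ?_⟩
  rintro r ⟨v, -, hv, rfl⟩
  exact sup_nonneg W hW v hv

lemma cc_A {d : ℕ} (V W : Submodule ℝ (EE d)) (hW : 1 ≤ finrank ℝ W) (v : EE d) (hvV : v ∈ V)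
    (hv : ‖v‖ = 1) : ∃ w ∈ W, ‖w‖ = 1 ∧ cc V W ≤ ⟪v, w⟫ := by
  have hK : IsCompact (Metric.sphere (0 : EE d) 1 ∩ (W : Set (EE d))) :=
    (isCompact_sphere _ _).inter_right W.closed_of_finiteDimensional
  obtain ⟨w₀, hw₀, hw₀1⟩ := exists_unit W hW
  obtain ⟨w, ⟨hw1, hwW⟩, hmax⟩ := hK.exists_isMaxOn (f := fun w => ⟪v, w⟫)
    ⟨w₀, by simpa using hw₀1, hw₀⟩ (by fun_prop)
  refine ⟨w, hwW, by simpa using hw1, ?_⟩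
  refine (csInf_le (bdd_out V W hW) ⟨v, hvV, hv, rfl⟩).trans ?_
  refine csSup_le ⟨_, w₀, hw₀, hw₀1, rfl⟩ ?_
  rintro c ⟨w', hw', hw'1, rfl⟩
  exact hmax ⟨by simpa using hw'1, hw'⟩

lemma cc_B {d : ℕ} (V W : Submodule ℝ (EE d)) (hV : 1 ≤ finrank ℝ V) (t : ℝ)
    (h : ∀ v ∈ V, ‖v‖ = 1 → ∃ w ∈ W, ‖w‖ = 1 ∧ t ≤ ⟪v, w⟫) : t ≤ cc V W := by
  obtain ⟨v₀, hv₀, hv₀1⟩ := exists_unit V hV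
  refine le_csInf ⟨_, v₀, hv₀, hv₀1, rfl⟩ ?_
  rintro r ⟨v, hv, hv1, rfl⟩
  obtain ⟨w, hw, hw1, hle⟩ := h v hv hv1
  exact hle.trans (le_csSup (bdd_in W v hv1) ⟨w, hw, hw1, rfl⟩)

lemma cc_nonneg {d : ℕ} (V W : Submodule ℝ (EE d)) (hV : 1 ≤ finrank ℝ V)
    (hW : 1 ≤ finrank ℝ W) : 0 ≤ cc V W := by
  obtain ⟨v₀, hv₀, hv₀1⟩ := exists_unit V hV
  refine le_csInf ⟨_, v₀, hv₀, hv₀1, rfl⟩ ?_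
  rintro r ⟨v, hv, hv1, rfl⟩
  exact sup_nonneg W hW v hv1

lemma cc_le_one {d : ℕ} (V W : Submodule ℝ (EE d)) (hV : 1 ≤ finrank ℝ V)
    (hW : 1 ≤ finrank ℝ W) : cc V W ≤ 1 := by
  obtain ⟨v₀, hv₀, hv₀1⟩ := exists_unit V hV
  obtain ⟨w, hw, hw1, h⟩ := cc_A V W hW v₀ hv₀ hv₀1
  exact h.trans (inner_le_one _ _ hv₀1 hw1)

lemma dist_eq {d : ℕ} (V W : Submodule ℝ (EE d)) (hV : 1 ≤ finrank ℝ V)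
    (hW : 1 ≤ finrank ℝ W) :
    2 * Real.sin (maxAngle V W / 2) = Real.sqrt (2 * (1 - cc V W)) := by
  have h0 := cc_nonneg V W hV hW
  have h1 := cc_le_one V W hV hW
  have hm : maxAngle V W = Real.arccos (cc V W) := rfl
  rw [hm, Real.sin_half_eq_sqrt (Real.arccos_nonneg _)
    (by linarith [Real.arccos_le_pi (cc V W), Real.pi_pos]),
    Real.cos_arccos (by linarith) h1]
  symm
  rw [Real.sqrt_eq_iff_mul_self_eq (by linarith) (by positivity)]
  have := Real.mul_self_sqrt (show 0 ≤ (1 - cc V W) / 2 by linarith)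
  first
    | linear_combination 4 * this
    | linear_combination (-4) * this

lemma dist_sq_aux {d : ℕ} (v w : EE d) (hv : ‖v‖ = 1) (hw : ‖w‖ = 1) :
    ‖v - w‖ ^ 2 = 2 * (1 - ⟪v, w⟫) := by
  rw [norm_sub_sq_real, hv, hw]; ring

lemma dist_A {d : ℕ} (V W : Submodule ℝ (EE d)) (hW : 1 ≤ finrank ℝ W)
    (v : EE d) (hvV : v ∈ V) (hv : ‖v‖ = 1) :
    ∃ w ∈ W, ‖w‖ = 1 ∧ ‖v - w‖ ≤ Real.sqrt (2 * (1 - cc V W)) := by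
  obtain ⟨w, hw, hw1, h⟩ := cc_A V W hW v hvV hv
  refine ⟨w, hw, hw1, Real.le_sqrt_of_sq_le ?_⟩
  rw [dist_sq_aux v w hv hw1]; linarith

lemma dist_B {d : ℕ} (V W : Submodule ℝ (EE d)) (hV : 1 ≤ finrank ℝ V) (r : ℝ)
    (h : ∀ v ∈ V, ‖v‖ = 1 → ∃ w ∈ W, ‖w‖ = 1 ∧ ‖v - w‖ ≤ r) :
    Real.sqrt (2 * (1 - cc V W)) ≤ r := by
  obtain ⟨v₀, hv₀, hv₀1⟩ := exists_unit V hV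
  obtain ⟨w₀, -, -, hr⟩ := h v₀ hv₀ hv₀1
  have hr0 : 0 ≤ r := (norm_nonneg _).trans hr
  rw [Real.sqrt_le_left hr0]
  have : 1 - r ^ 2 / 2 ≤ cc V W := by
    refine cc_B V W hV _ fun v hv hv1 => ?_
    obtain ⟨w, hw, hw1, hle⟩ := h v hv hv1
    refine ⟨w, hw, hw1, ?_⟩
    have h2 := dist_sq_aux v w hv1 hw1
    have h3 : ‖v - w‖ ^ 2 ≤ r ^ 2 := by gcongr
    linarith
  linarith

lemma cc_symm_le {d : ℕ} (V W : Submodule ℝ (EE d)) (hV : 1 ≤ finrank ℝ V)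
    (hVW : finrank ℝ V = finrank ℝ W) : cc V W ≤ cc W V := by
  have hW : 1 ≤ finrank ℝ W := hVW ▸ hV
  rcases (cc_nonneg V W hV hW).eq_or_lt with h0 | h0
  · rw [← h0]; exact cc_nonneg W V hW hV
  set c := cc V W with hc
  let A : V →ₗ[ℝ] W := (W.orthogonalProjectionOnto : EE d →ₗ[ℝ] W) ∘ₗ V.subtype
  have hA : ∀ (v : V) (w : W), ⟪((A v : W) : EE d), (w : EE d)⟫ = ⟪(v : EE d), (w : EE d)⟫ := by
    intro v w
    have h := Submodule.inner_orthogonalProjectionOnto_eq_of_mem_left w (v : EE d)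
    rw [real_inner_comm, real_inner_comm (w : EE d)]
    exact h
  have hlow : ∀ v : V, c * ‖v‖ ≤ ‖A v‖ := by
    intro v
    by_cases hv : v = 0
    · simp [hv]
    have hvn : 0 < ‖v‖ := norm_pos_iff.2 hv
    obtain ⟨w, hw, hw1, hle⟩ := cc_A V W hW ((‖v‖⁻¹ : ℝ) • (v : EE d)) (V.smul_mem _ v.2) (by
      rw [norm_smul, norm_inv, norm_norm]
      exact inv_mul_cancel₀ hvn.ne')
    rw [real_inner_smul_left, ← hA v ⟨w, hw⟩] at hle
    have h2 := real_inner_le_norm ((A v : W) : EE d) w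
    rw [hw1, mul_one] at h2
    have h3 : c ≤ ‖v‖⁻¹ * ‖A v‖ := hle.trans (mul_le_mul_of_nonneg_left h2 (by positivity))
    calc c * ‖v‖ ≤ ‖v‖⁻¹ * ‖A v‖ * ‖v‖ := by gcongr
      _ = ‖A v‖ := by field_simp
  have hinj : Function.Injective A := by
    rw [← LinearMap.ker_eq_bot, LinearMap.ker_eq_bot']
    intro v hv
    have := hlow v
    rw [hv, norm_zero] at this
    have : ‖v‖ ≤ 0 := by
      by_contra hcon
      push Not at hcon
      nlinarith
    exact norm_le_zero_iff.1 this
  have hsurj : Function.Surjective A :=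
    (LinearMap.injective_iff_surjective_of_finrank_eq_finrank hVW).1 hinj
  refine cc_B W V hW c fun w hw hw1 => ?_
  obtain ⟨v, hv⟩ := hsurj ⟨w, hw⟩
  have h1 := hlow v
  have hwn : ‖(⟨w, hw⟩ : W)‖ = 1 := hw1
  rw [hv, hwn] at h1
  have hv0 : v ≠ 0 := by
    rintro rfl
    rw [map_zero] at hv
    rw [← hv, norm_zero] at hwn
    exact zero_ne_one hwn
  have hvn : 0 < ‖v‖ := norm_pos_iff.2 hv0
  refine ⟨(‖v‖⁻¹ : ℝ) • (v : EE d), V.smul_mem _ v.2, ?_, ?_⟩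
  · rw [norm_smul, norm_inv, norm_norm]
    exact inv_mul_cancel₀ hvn.ne'
  · have h2 := hA v ⟨w, hw⟩
    rw [hv] at h2
    simp only [real_inner_self_eq_norm_sq, hw1] at h2
    rw [real_inner_smul_right, real_inner_comm, ← h2]
    rw [one_pow, mul_one, ← one_div, le_div_iff₀ hvn]
    exact h1

lemma cc_eq_one_iff {d : ℕ} (V W : Submodule ℝ (EE d)) (hV : 1 ≤ finrank ℝ V)
    (hVW : finrank ℝ V = finrank ℝ W) : cc V W = 1 ↔ V = W := by
  have hW : 1 ≤ finrank ℝ W := hVW ▸ hV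
  constructor
  · intro h
    refine Submodule.eq_of_le_of_finrank_eq ?_ hVW
    intro v hv
    by_cases hv0 : v = 0
    · simp [hv0]
    have hvn : 0 < ‖v‖ := norm_pos_iff.2 hv0
    have hu : ‖(‖v‖⁻¹ : ℝ) • v‖ = 1 := by
      rw [norm_smul, norm_inv, norm_norm]
      exact inv_mul_cancel₀ hvn.ne'
    obtain ⟨w, hw, hw1, hle⟩ := dist_A V W hW ((‖v‖⁻¹ : ℝ) • v) (V.smul_mem _ hv) hu
    rw [h, sub_self, mul_zero, Real.sqrt_zero] at hle
    have := sub_eq_zero.1 (norm_le_zero_iff.1 hle)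
    have h2 : v = ‖v‖ • w := by rw [← this, smul_smul, mul_inv_cancel₀ hvn.ne', one_smul]
    rw [h2]
    exact W.smul_mem _ hw
  · rintro rfl
    refine le_antisymm (cc_le_one V V hV hV) (cc_B V V hV 1 fun v hv hv1 => ⟨v, hv, hv1, ?_⟩)
    rw [real_inner_self_eq_norm_sq, hv1]; norm_num

lemma toE_mul {a b c : ℕ} (A : Matrix (Fin a) (Fin b) ℝ) (B : Matrix (Fin b) (Fin c) ℝ)
    (x : EE c) : Matrix.toEuclideanLin (A * B) x =
      Matrix.toEuclideanLin A (Matrix.toEuclideanLin B x) := by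
  ext i
  simp [Matrix.toLpLin_apply]

lemma toE_inner {a b c : ℕ} (A : Matrix (Fin a) (Fin b) ℝ) (B : Matrix (Fin a) (Fin c) ℝ)
    (x : EE b) (y : EE c) :
    ⟪Matrix.toEuclideanLin A x, Matrix.toEuclideanLin B y⟫ =
      ⟪x, Matrix.toEuclideanLin (Aᵀ * B) y⟫ := by
  rw [toE_mul, ← Matrix.conjTranspose_eq_transpose_of_trivial,
    Matrix.toEuclideanLin_conjTranspose_eq_adjoint, LinearMap.adjoint_inner_right]

lemma toE_norm {a b : ℕ} (A : Matrix (Fin a) (Fin b) ℝ) (hA : Aᵀ * A = 1) (x : EE b) :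
    ‖Matrix.toEuclideanLin A x‖ = ‖x‖ := by
  have h := toE_inner A A x x
  have h1 : Matrix.toEuclideanLin (1 : Matrix (Fin b) (Fin b) ℝ) x = x := by
    simp
  rw [hA, h1, real_inner_self_eq_norm_sq, real_inner_self_eq_norm_sq] at h
  exact (sq_eq_sq₀ (norm_nonneg _) (norm_nonneg _)).1 h

lemma orth_mul {a b : ℕ} (A : Matrix (Fin a) (Fin b) ℝ) (Q : Matrix (Fin b) (Fin b) ℝ)
    (hA : Aᵀ * A = 1) (hQ : Qᵀ * Q = 1) : (A * Q)ᵀ * (A * Q) = 1 := by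
  rw [Matrix.transpose_mul, Matrix.mul_assoc, ← Matrix.mul_assoc Aᵀ, hA, Matrix.one_mul, hQ]

lemma range_mul {a b : ℕ} (A : Matrix (Fin a) (Fin b) ℝ) (Q : Matrix (Fin b) (Fin b) ℝ)
    (hQ : Qᵀ * Q = 1) : LinearMap.range (Matrix.toEuclideanLin (A * Q)) =
      LinearMap.range (Matrix.toEuclideanLin A) := by
  apply le_antisymm
  · rintro _ ⟨x, rfl⟩
    exact ⟨_, (toE_mul A Q x).symm⟩
  · rintro _ ⟨x, rfl⟩
    refine ⟨Matrix.toEuclideanLin Qᵀ x, ?_⟩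
    rw [← toE_mul, Matrix.mul_assoc, mul_eq_one_comm.1 hQ, Matrix.mul_one]

lemma range_finrank {a b : ℕ} (A : Matrix (Fin a) (Fin b) ℝ) (hA : Aᵀ * A = 1) :
    finrank ℝ (LinearMap.range (Matrix.toEuclideanLin A)) = b := by
  rw [LinearMap.finrank_range_of_inj]
  · simp
  · rw [← LinearMap.ker_eq_bot, LinearMap.ker_eq_bot']
    intro x hx
    have := toE_norm A hA x
    rw [hx, norm_zero] at this
    exact norm_eq_zero.1 this.symm

lemma dist_le_sNorm {d s : ℕ} (hs : 1 ≤ s) (A B : Matrix (Fin d) (Fin s) ℝ)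
    (hA : Aᵀ * A = 1) (hB : Bᵀ * B = 1) :
    Real.sqrt (2 * (1 - cc (LinearMap.range (Matrix.toEuclideanLin A))
      (LinearMap.range (Matrix.toEuclideanLin B)))) ≤ sNorm (A - B) := by
  refine dist_B _ _ (by rw [range_finrank A hA]; exact hs) _ ?_
  rintro _ ⟨x, rfl⟩ hx
  rw [toE_norm A hA] at hx
  refine ⟨_, ⟨x, rfl⟩, by rw [toE_norm B hB, hx], ?_⟩
  have h := (LinearMap.toContinuousLinearMap (Matrix.toEuclideanLin (A - B))).le_opNorm x
  rw [hx, mul_one] at h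
  simpa [sNorm, map_sub] using h

lemma diag_inner {s : ℕ} (σ : Fin s → ℝ) (x y : EE s) :
    ⟪x, Matrix.toEuclideanLin (Matrix.diagonal σ) y⟫ = ∑ i, σ i * (x i * y i) := by
  rw [PiLp.inner_apply]
  refine Finset.sum_congr rfl fun i _ => ?_
  simp [Matrix.toLpLin_apply, Matrix.mulVec_diagonal]
  ring

lemma diag_ge {s : ℕ} (σ : Fin s → ℝ) (t : ℝ) (ht : ∀ j, t ≤ σ j) (x : EE s) :
    t * ‖x‖ ^ 2 ≤ ⟪x, Matrix.toEuclideanLin (Matrix.diagonal σ) x⟫ := by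
  rw [diag_inner, EuclideanSpace.real_norm_sq_eq, Finset.mul_sum]
  refine Finset.sum_le_sum fun i _ => ?_
  rw [sq]
  exact mul_le_mul_of_nonneg_right (ht i) (mul_self_nonneg _)

lemma cc_diag {d s : ℕ} (hs : 1 ≤ s) (A B : Matrix (Fin d) (Fin s) ℝ)
    (hA : Aᵀ * A = 1) (hB : Bᵀ * B = 1) (σ : Fin s → ℝ) (k : Fin s) (h0 : 0 ≤ σ k)
    (hk : ∀ j, σ k ≤ σ j) (hAB : Aᵀ * B = Matrix.diagonal σ) :
    cc (LinearMap.range (Matrix.toEuclideanLin A))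
      (LinearMap.range (Matrix.toEuclideanLin B)) = σ k := by
  apply le_antisymm
  · obtain ⟨w, ⟨z, rfl⟩, hw1, hle⟩ := cc_A (LinearMap.range (Matrix.toEuclideanLin A))
      (LinearMap.range (Matrix.toEuclideanLin B)) (by rw [range_finrank B hB]; exact hs)
      (Matrix.toEuclideanLin A (EuclideanSpace.single k 1)) ⟨_, rfl⟩
      (by rw [toE_norm A hA]; simp)
    rw [toE_norm B hB] at hw1
    refine hle.trans ?_
    rw [toE_inner, hAB, diag_inner, Finset.sum_eq_single k]
    · have : z k ≤ 1 := by
        have := PiLp.norm_apply_le z k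
        rw [hw1] at this
        exact (le_abs_self _).trans this
      simpa using mul_le_mul_of_nonneg_left this h0
    · intro j _ hj
      simp [hj]
    · simp
  · refine cc_B _ _ (by rw [range_finrank A hA]; exact hs) _ ?_
    rintro _ ⟨x, rfl⟩ hx
    rw [toE_norm A hA] at hx
    refine ⟨_, ⟨x, rfl⟩, by rw [toE_norm B hB, hx], ?_⟩
    rw [toE_inner, hAB]
    have := diag_ge σ (σ k) hk x
    rwa [hx, one_pow, mul_one] at this

lemma sNorm_le_diag {d s : ℕ} (A B : Matrix (Fin d) (Fin s) ℝ)
    (hA : Aᵀ * A = 1) (hB : Bᵀ * B = 1) (σ : Fin s → ℝ) (k : Fin s)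
    (hk : ∀ j, σ k ≤ σ j) (hAB : Aᵀ * B = Matrix.diagonal σ) :
    sNorm (A - B) ≤ Real.sqrt (2 * (1 - σ k)) := by
  refine ContinuousLinearMap.opNorm_le_bound _ (Real.sqrt_nonneg _) fun x => ?_
  have e : LinearMap.toContinuousLinearMap (Matrix.toEuclideanLin (A - B)) x =
      Matrix.toEuclideanLin A x - Matrix.toEuclideanLin B x := by simp [map_sub]
  have h1 := diag_ge σ (σ k) hk x
  have h2 : ‖Matrix.toEuclideanLin A x - Matrix.toEuclideanLin B x‖ ^ 2 ≤
      2 * (1 - σ k) * ‖x‖ ^ 2 := by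
    rw [norm_sub_sq_real, toE_norm A hA, toE_norm B hB, toE_inner, hAB]
    linarith
  rw [e]
  have h3 := Real.le_sqrt_of_sq_le h2
  rwa [Real.sqrt_mul' _ (by positivity), Real.sqrt_sq (norm_nonneg _)] at h3

/-- Let `P₁, P₂ ∈ ℝ^{d×s}` have orthonormal columns and `P₁ᵀP₂ = YΣZᵀ` be an SVD with
singular values `σ₁ ≥ … ≥ σ_s ≥ 0`. Then the minimum of `‖P₁Q₁ − P₂Q₂‖` over
orthogonal `Q₁, Q₂` equals `√(2(1−σ_s)) = 2 sin(φ_s/2)` with `φ_s` the maximal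
principal angle between the ranges, attained at `Q₁ = Y, Q₂ = Z`; moreover
`d_σ(V₁,V₂) := 2 sin(∠(V₁,V₂)/2)` defines a metric on `G(s,d)`. -/
theorem stmt2 (d s : ℕ) (hs : 1 ≤ s)
    (P₁ P₂ : Matrix (Fin d) (Fin s) ℝ)
    (hP₁ : P₁ᵀ * P₁ = 1) (hP₂ : P₂ᵀ * P₂ = 1)
    (Y Z : Matrix (Fin s) (Fin s) ℝ) (σ : Fin s → ℝ)
    (hY : Yᵀ * Y = 1) (hZ : Zᵀ * Z = 1)
    (hσ0 : ∀ j, 0 ≤ σ j) (hσmono : Antitone σ)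
    (hSVD : P₁ᵀ * P₂ = Y * Matrix.diagonal σ * Zᵀ) :
    IsLeast {r : ℝ | ∃ Q₁ Q₂ : Matrix (Fin s) (Fin s) ℝ,
        Q₁ᵀ * Q₁ = 1 ∧ Q₂ᵀ * Q₂ = 1 ∧ r = sNorm (P₁ * Q₁ - P₂ * Q₂)}
      (Real.sqrt (2 * (1 - σ ⟨s - 1, by omega⟩))) ∧
    Real.sqrt (2 * (1 - σ ⟨s - 1, by omega⟩)) =
      2 * Real.sin (maxAngle (LinearMap.range (Matrix.toEuclideanLin P₁))
        (LinearMap.range (Matrix.toEuclideanLin P₂)) / 2) ∧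
    sNorm (P₁ * Y - P₂ * Z) = Real.sqrt (2 * (1 - σ ⟨s - 1, by omega⟩)) ∧
    ((∀ V W : Submodule ℝ (EuclideanSpace ℝ (Fin d)),
      finrank ℝ V = s → finrank ℝ W = s → 0 ≤ 2 * Real.sin (maxAngle V W / 2)) ∧
    (∀ V W : Submodule ℝ (EuclideanSpace ℝ (Fin d)),
      finrank ℝ V = s → finrank ℝ W = s →
      (2 * Real.sin (maxAngle V W / 2) = 0 ↔ V = W)) ∧
    (∀ V W : Submodule ℝ (EuclideanSpace ℝ (Fin d)),
      finrank ℝ V = s → finrank ℝ W = s →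
      2 * Real.sin (maxAngle V W / 2) = 2 * Real.sin (maxAngle W V / 2)) ∧
    (∀ U V W : Submodule ℝ (EuclideanSpace ℝ (Fin d)),
      finrank ℝ U = s → finrank ℝ V = s → finrank ℝ W = s →
      2 * Real.sin (maxAngle U W / 2) ≤
        2 * Real.sin (maxAngle U V / 2) + 2 * Real.sin (maxAngle V W / 2))) := by
  have hYZ : (P₁ * Y)ᵀ * (P₂ * Z) = Matrix.diagonal σ := by
    rw [Matrix.transpose_mul, Matrix.mul_assoc, ← Matrix.mul_assoc P₁ᵀ, hSVD]
    simp only [Matrix.mul_assoc]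
    rw [hZ, Matrix.mul_one, ← Matrix.mul_assoc, hY, Matrix.one_mul]
  have hAY := orth_mul P₁ Y hP₁ hY
  have hBZ := orth_mul P₂ Z hP₂ hZ
  have hk : ∀ j, σ ⟨s - 1, by omega⟩ ≤ σ j := fun j =>
    hσmono (by rw [Fin.le_def]; simp only; omega)
  have hcc := cc_diag hs (P₁ * Y) (P₂ * Z) hAY hBZ σ ⟨s - 1, by omega⟩ (hσ0 _) hk hYZ
  rw [range_mul _ _ hY, range_mul _ _ hZ] at hcc
  have hlow : ∀ Q₁ Q₂ : Matrix (Fin s) (Fin s) ℝ, Q₁ᵀ * Q₁ = 1 → Q₂ᵀ * Q₂ = 1 →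
      Real.sqrt (2 * (1 - σ ⟨s - 1, by omega⟩)) ≤ sNorm (P₁ * Q₁ - P₂ * Q₂) := by
    intro Q₁ Q₂ h1 h2
    have := dist_le_sNorm hs (P₁ * Q₁) (P₂ * Q₂) (orth_mul _ _ hP₁ h1) (orth_mul _ _ hP₂ h2)
    rwa [range_mul _ _ h1, range_mul _ _ h2, hcc] at this
  have hatt : sNorm (P₁ * Y - P₂ * Z) = Real.sqrt (2 * (1 - σ ⟨s - 1, by omega⟩)) :=
    le_antisymm (sNorm_le_diag _ _ hAY hBZ σ _ hk hYZ) (hlow Y Z hY hZ)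
  refine ⟨⟨⟨Y, Z, hY, hZ, hatt.symm⟩, ?_⟩, ?_, hatt, ?_, ?_, ?_, ?_⟩
  · rintro r ⟨Q₁, Q₂, h1, h2, rfl⟩
    exact hlow Q₁ Q₂ h1 h2
  · rw [dist_eq _ _ (by rw [range_finrank _ hP₁]; exact hs)
      (by rw [range_finrank _ hP₂]; exact hs), hcc]
  · intro V W hV hW
    rw [dist_eq V W (le_of_le_of_eq hs hV.symm) (le_of_le_of_eq hs hW.symm)]
    exact Real.sqrt_nonneg _
  · intro V W hV hW
    have h1 := cc_le_one V W (le_of_le_of_eq hs hV.symm) (le_of_le_of_eq hs hW.symm)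
    rw [dist_eq V W (le_of_le_of_eq hs hV.symm) (le_of_le_of_eq hs hW.symm), ← cc_eq_one_iff V W (le_of_le_of_eq hs hV.symm) (hV.trans hW.symm),
      Real.sqrt_eq_zero (by linarith)]
    constructor <;> intro h <;> linarith
  · intro V W hV hW
    rw [dist_eq V W (le_of_le_of_eq hs hV.symm) (le_of_le_of_eq hs hW.symm), dist_eq W V (le_of_le_of_eq hs hW.symm) (le_of_le_of_eq hs hV.symm),
      le_antisymm (cc_symm_le V W (le_of_le_of_eq hs hV.symm) (hV.trans hW.symm)) (cc_symm_le W V (le_of_le_of_eq hs hW.symm) (hW.trans hV.symm))]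
  · intro U V W hU hV hW
    rw [dist_eq U W (le_of_le_of_eq hs hU.symm) (le_of_le_of_eq hs hW.symm), dist_eq U V (le_of_le_of_eq hs hU.symm) (le_of_le_of_eq hs hV.symm),
      dist_eq V W (le_of_le_of_eq hs hV.symm) (le_of_le_of_eq hs hW.symm)]
    refine dist_B U W (le_of_le_of_eq hs hU.symm) _ fun u hu hu1 => ?_
    obtain ⟨v, hv, hv1, h1⟩ := dist_A U V (le_of_le_of_eq hs hV.symm) u hu hu1
    obtain ⟨w, hw, hw1, h2⟩ := dist_A V W (le_of_le_of_eq hs hW.symm) v hv hv1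
    exact ⟨w, hw, hw1, (norm_sub_le_norm_sub_add_norm_sub u v w).trans (add_le_add h1 h2)⟩
end

section
/- Two matrices Q₁, Q₂ ∈ ℝ^{d×s} satisfy Q₁u ≠ 0, Q₂v ≠ 0 and ∠(Q₁u, Q₂v) = ∠(u,v) for all nonzero u, v ∈ ℝ^s if and only if there exist constants c₁, c₂ ≠ 0 such that Q₁ᵀQ₁ = c₁²I_s, Q₂ᵀQ₂ = c₂²I_s and Q₁ᵀQ₂ = c₁c₂I_s. In the case s = d this is equivalent to the existence of c₁, c₂ ≠ 0 and an orthogonal matrix Q ∈ O(d) with Q₁ = c₁Q and Q₂ = c₂Q. -/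
open scoped Matrix RealInnerProductSpace
open Module

/-- The principal angle `∠(v,w) = arccos(|vᵀw|/(‖v‖‖w‖))` between the spans of two
nonzero vectors. -/
noncomputable def angVec {n : ℕ} (v w : EuclideanSpace ℝ (Fin n)) : ℝ :=
  Real.arccos (|⟪v, w⟫| / (‖v‖ * ‖w‖))

lemma conn_aux {E : Type*} [NormedAddCommGroup E] [InnerProductSpace ℝ E] (h : E → ℝ)
    (hh : ∀ u v : E, u ≠ 0 → v ≠ 0 → ⟪u, v⟫ ≠ 0 → h u = h v) (u v : E) (hu : u ≠ 0) (hv : v ≠ 0) :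
    h u = h v := by
  by_cases huv : ⟪u, v⟫ = 0
  · have hvu : ⟪v, u⟫ = 0 := by rw [real_inner_comm]; exact huv
    have h1 : ⟪u, u + v⟫ ≠ 0 := by
      rw [inner_add_right, huv, add_zero]; exact inner_self_ne_zero.mpr hu
    have h2 : ⟪v, u + v⟫ ≠ 0 := by
      rw [inner_add_right, hvu, zero_add]; exact inner_self_ne_zero.mpr hv
    have h3 : u + v ≠ 0 := by
      intro h0; rw [h0, inner_zero_right] at h1; exact h1 rfl
    exact (hh u _ hu h3 h1).trans (hh v _ hv h3 h2).symm
  · exact hh u v hu hv huv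

lemma inner_of_norm {E F : Type*} [NormedAddCommGroup E] [InnerProductSpace ℝ E]
    [NormedAddCommGroup F] [InnerProductSpace ℝ F] (A : E →ₗ[ℝ] F) (a : ℝ)
    (h : ∀ u, ‖A u‖ = a * ‖u‖) (u v : E) : ⟪A u, A v⟫ = a ^ 2 * ⟪u, v⟫ := by
  rw [real_inner_eq_norm_add_mul_self_sub_norm_mul_self_sub_norm_mul_self_div_two,
    real_inner_eq_norm_add_mul_self_sub_norm_mul_self_sub_norm_mul_self_div_two, ← map_add,
    h, h, h]
  ring

lemma main_aux {s d : ℕ} (A B : EuclideanSpace ℝ (Fin s) →ₗ[ℝ] EuclideanSpace ℝ (Fin d)) :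
    (∀ u v, u ≠ 0 → v ≠ 0 → A u ≠ 0 ∧ B v ≠ 0 ∧ angVec (A u) (B v) = angVec u v) ↔
    ∃ c₁ c₂ : ℝ, c₁ ≠ 0 ∧ c₂ ≠ 0 ∧ (∀ u v, ⟪A u, A v⟫ = c₁ ^ 2 * ⟪u, v⟫) ∧
      (∀ u v, ⟪B u, B v⟫ = c₂ ^ 2 * ⟪u, v⟫) ∧ (∀ u v, ⟪A u, B v⟫ = (c₁ * c₂) * ⟪u, v⟫) := by
  constructor
  · intro H
    by_cases hE : ∃ e : EuclideanSpace ℝ (Fin s), e ≠ 0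
    swap
    · push Not at hE
      refine ⟨1, 1, one_ne_zero, one_ne_zero, ?_, ?_, ?_⟩ <;> intro u v <;> simp [hE u]
    obtain ⟨e, he⟩ := hE
    have key : ∀ u v, u ≠ 0 → v ≠ 0 →
        |⟪A u, B v⟫| * (‖u‖ * ‖v‖) = |⟪u, v⟫| * (‖A u‖ * ‖B v‖) := by
      intro u v hu hv
      obtain ⟨h1, h2, h3⟩ := H u v hu hv
      have e1 := abs_real_inner_div_norm_mul_norm_le_one u v
      have e2 := abs_real_inner_div_norm_mul_norm_le_one (A u) (B v)
      have p : ∀ {n : ℕ} (x y : EuclideanSpace ℝ (Fin n)), 0 ≤ |⟪x, y⟫| / (‖x‖ * ‖y‖) :=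
        fun x y => by positivity
      rw [abs_div, abs_of_nonneg (by positivity : 0 ≤ ‖u‖ * ‖v‖)] at e1
      rw [abs_div, abs_of_nonneg (by positivity : 0 ≤ ‖A u‖ * ‖B v‖)] at e2
      have h4 := Real.arccos_injOn ⟨by linarith [p (A u) (B v)], e2⟩
        ⟨by linarith [p u v], e1⟩ h3
      have q1 := norm_pos_iff.mpr hu
      have q2 := norm_pos_iff.mpr hv
      have q3 := norm_pos_iff.mpr h1
      have q4 := norm_pos_iff.mpr h2
      rwa [div_eq_div_iff (by positivity) (by positivity)] at h4
    have orth : ∀ u v, u ≠ 0 → ⟪u, v⟫ = 0 → ⟪A u, B v⟫ = 0 := by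
      intro u v hu h
      by_cases hv : v = 0
      · simp [hv]
      have := key u v hu hv
      rw [h] at this
      have q1 := norm_pos_iff.mpr hu
      have q2 := norm_pos_iff.mpr hv
      have q3 : ‖u‖ * ‖v‖ ≠ 0 := by positivity
      simpa [q1.ne', q2.ne'] using this
    have orth' : ∀ u v, v ≠ 0 → ⟪u, v⟫ = 0 → ⟪A u, B v⟫ = 0 := by
      intro u v hv h
      by_cases hu : u = 0
      · simp [hu]
      exact orth u v hu h
    have r1 : ∀ u v, u ≠ 0 → ⟪A u, B v⟫ = ⟪u, v⟫ * (⟪A u, B u⟫ / ⟪u, u⟫) := by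
      intro u v hu
      have h0 : ⟪u, u⟫ ≠ 0 := inner_self_ne_zero.mpr hu
      have := orth u (v - (⟪u, v⟫ / ⟪u, u⟫) • u) hu (by
        rw [inner_sub_right, inner_smul_right]; field_simp; ring)
      rw [map_sub, map_smul, inner_sub_right, inner_smul_right] at this
      rw [sub_eq_zero.mp this]; ring
    have r2 : ∀ u v, v ≠ 0 → ⟪A u, B v⟫ = ⟪u, v⟫ * (⟪A v, B v⟫ / ⟪v, v⟫) := by
      intro u v hv
      have h0 : ⟪v, v⟫ ≠ 0 := inner_self_ne_zero.mpr hv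
      have := orth' (u - (⟪u, v⟫ / ⟪v, v⟫) • v) v hv (by
        rw [inner_sub_left, real_inner_smul_left]; field_simp; ring)
      rw [map_sub, map_smul, inner_sub_left, real_inner_smul_left] at this
      rw [sub_eq_zero.mp this]; ring
    have hm := fun u hu => conn_aux (fun u => ⟪A u, B u⟫ / ⟪u, u⟫) (by
      intro u v hu hv huv
      exact mul_left_cancel₀ huv ((r1 u v hu).symm.trans (r2 u v hv))) u e hu he
    obtain ⟨m, hm'⟩ : ∃ m, m = ⟪A e, B e⟫ / ⟪e, e⟫ := ⟨_, rfl⟩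
    have hM : ∀ u v, ⟪A u, B v⟫ = m * ⟪u, v⟫ := by
      intro u v
      by_cases hu : u = 0
      · simp [hu]
      have := hm u hu
      rw [r1 u v hu, this, hm']; ring
    have key2 : ∀ u v, u ≠ 0 → v ≠ 0 → ⟪u, v⟫ ≠ 0 →
        |m| = (‖A u‖ / ‖u‖) * (‖B v‖ / ‖v‖) := by
      intro u v hu hv huv
      have h := key u v hu hv
      have q1 := norm_pos_iff.mpr hu
      have q2 := norm_pos_iff.mpr hv
      rw [hM, abs_mul] at h
      have h5 : |⟪u, v⟫| ≠ 0 := abs_ne_zero.mpr huv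
      have h6 : |m| * (‖u‖ * ‖v‖) = ‖A u‖ * ‖B v‖ := by
        apply mul_left_cancel₀ h5; linarith
      field_simp
      linarith
    have pA : ∀ u, u ≠ 0 → 0 < ‖A u‖ / ‖u‖ := fun u hu =>
      div_pos (norm_pos_iff.mpr (H u u hu hu).1) (norm_pos_iff.mpr hu)
    have pB : ∀ u, u ≠ 0 → 0 < ‖B u‖ / ‖u‖ := fun u hu =>
      div_pos (norm_pos_iff.mpr (H u u hu hu).2.1) (norm_pos_iff.mpr hu)
    have fA := fun u hu => conn_aux (fun u => ‖A u‖ / ‖u‖) (by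
      intro u v hu hv huv
      exact mul_right_cancel₀ (pB v hv).ne' ((key2 u v hu hv huv).symm.trans
        (key2 v v hv hv (inner_self_ne_zero.mpr hv)))) u e hu he
    have fB := fun u hu => conn_aux (fun u => ‖B u‖ / ‖u‖) (by
      intro u v hu hv huv
      exact mul_left_cancel₀ (pA u hu).ne' ((key2 u u hu hu (inner_self_ne_zero.mpr hu)).symm.trans
        (key2 u v hu hv huv))) u e hu he
    have hab := key2 e e he he (inner_self_ne_zero.mpr he)
    have ha := pA e he
    have hb := pB e he
    generalize ‖A e‖ / ‖e‖ = a at *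
    generalize ‖B e‖ / ‖e‖ = b at *
    have nA : ∀ u, ‖A u‖ = a * ‖u‖ := by
      intro u
      by_cases hu : u = 0
      · simp [hu]
      exact (div_eq_iff (norm_ne_zero_iff.mpr hu)).mp (fA u hu)
    have nB : ∀ u, ‖B u‖ = b * ‖u‖ := by
      intro u
      by_cases hu : u = 0
      · simp [hu]
      exact (div_eq_iff (norm_ne_zero_iff.mpr hu)).mp (fB u hu)
    have hm0 : m ≠ 0 := abs_pos.mp (hab ▸ mul_pos ha hb)
    have hsq : (m / a) ^ 2 = b ^ 2 := by
      rw [div_pow, ← sq_abs m, hab]; field_simp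
    refine ⟨a, m / a, ha.ne', div_ne_zero hm0 ha.ne', inner_of_norm A a nA, ?_, ?_⟩
    · rw [hsq]; exact inner_of_norm B b nB
    · rw [mul_div_cancel₀ _ ha.ne']; exact hM
  · rintro ⟨c₁, c₂, h1, h2, hA, hB, hAB⟩ u v hu hv
    have nA : ‖A u‖ = |c₁| * ‖u‖ := by
      rw [← sq_eq_sq₀ (by positivity) (by positivity), ← real_inner_self_eq_norm_sq, hA, mul_pow,
        sq_abs, real_inner_self_eq_norm_sq]
    have nB : ‖B v‖ = |c₂| * ‖v‖ := by
      rw [← sq_eq_sq₀ (by positivity) (by positivity), ← real_inner_self_eq_norm_sq, hB, mul_pow,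
        sq_abs, real_inner_self_eq_norm_sq]
    have q1 := norm_pos_iff.mpr hu
    have q2 := norm_pos_iff.mpr hv
    have q3 := abs_pos.mpr h1
    have q4 := abs_pos.mpr h2
    refine ⟨?_, ?_, ?_⟩
    · rw [← norm_pos_iff, nA]; positivity
    · rw [← norm_pos_iff, nB]; positivity
    · unfold angVec
      rw [nA, nB, hAB, abs_mul, abs_mul]
      congr 1
      field_simp

lemma bridge {s d : ℕ} (Q R : Matrix (Fin d) (Fin s) ℝ) (c : ℝ) :
    (∀ u v, ⟪Matrix.toEuclideanLin Q u, Matrix.toEuclideanLin R v⟫ = c * ⟪u, v⟫) ↔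
      Qᵀ * R = c • (1 : Matrix (Fin s) (Fin s) ℝ) := by
  have h : ∀ u v, ⟪Matrix.toEuclideanLin Q u, Matrix.toEuclideanLin R v⟫
      = u.ofLp ⬝ᵥ ((Qᵀ * R) *ᵥ v.ofLp) := by
    intro u v
    rw [EuclideanSpace.inner_eq_star_dotProduct, ← Matrix.mulVec_mulVec,
      Matrix.dotProduct_mulVec, Matrix.vecMul_transpose, dotProduct_comm]
    simp [Matrix.toLpLin_apply]
  have h' : ∀ u v : EuclideanSpace ℝ (Fin s), ⟪u, v⟫ = u.ofLp ⬝ᵥ v.ofLp := by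
    intro u v
    rw [EuclideanSpace.inner_eq_star_dotProduct, dotProduct_comm]
    simp
  constructor
  · intro H
    ext i j
    have := H (WithLp.toLp 2 (Pi.single i 1)) (WithLp.toLp 2 (Pi.single j 1))
    rw [h, h'] at this
    simpa [Matrix.one_apply, Pi.single_apply, eq_comm (a := j) (b := i)] using this
  · intro H u v
    rw [h, h', H]
    simp [Matrix.smul_mulVec]

lemma part1 (d s : ℕ) (Q₁ Q₂ : Matrix (Fin d) (Fin s) ℝ) :
    ((∀ u v : EuclideanSpace ℝ (Fin s), u ≠ 0 → v ≠ 0 →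
        Matrix.toEuclideanLin Q₁ u ≠ 0 ∧ Matrix.toEuclideanLin Q₂ v ≠ 0 ∧
        angVec (Matrix.toEuclideanLin Q₁ u) (Matrix.toEuclideanLin Q₂ v) = angVec u v)
      ↔ (∃ c₁ c₂ : ℝ, c₁ ≠ 0 ∧ c₂ ≠ 0 ∧
          Q₁ᵀ * Q₁ = (c₁ ^ 2) • (1 : Matrix (Fin s) (Fin s) ℝ) ∧
          Q₂ᵀ * Q₂ = (c₂ ^ 2) • (1 : Matrix (Fin s) (Fin s) ℝ) ∧
          Q₁ᵀ * Q₂ = (c₁ * c₂) • (1 : Matrix (Fin s) (Fin s) ℝ))) := by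
  rw [main_aux]
  simp only [bridge]

/-- Two matrices `Q₁, Q₂ ∈ ℝ^{d×s}` satisfy `Q₁u ≠ 0`, `Q₂v ≠ 0` and
`∠(Q₁u, Q₂v) = ∠(u,v)` for all nonzero `u, v ∈ ℝ^s` iff there are `c₁, c₂ ≠ 0` with
`Q₁ᵀQ₁ = c₁²I`, `Q₂ᵀQ₂ = c₂²I`, `Q₁ᵀQ₂ = c₁c₂I`; for `s = d` this is equivalent to
`Q₁ = c₁Q`, `Q₂ = c₂Q` for some orthogonal `Q`. -/
theorem stmt3 (d s : ℕ) (Q₁ Q₂ : Matrix (Fin d) (Fin s) ℝ) :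
    ((∀ u v : EuclideanSpace ℝ (Fin s), u ≠ 0 → v ≠ 0 →
        Matrix.toEuclideanLin Q₁ u ≠ 0 ∧ Matrix.toEuclideanLin Q₂ v ≠ 0 ∧
        angVec (Matrix.toEuclideanLin Q₁ u) (Matrix.toEuclideanLin Q₂ v) = angVec u v)
      ↔ (∃ c₁ c₂ : ℝ, c₁ ≠ 0 ∧ c₂ ≠ 0 ∧
          Q₁ᵀ * Q₁ = (c₁ ^ 2) • (1 : Matrix (Fin s) (Fin s) ℝ) ∧
          Q₂ᵀ * Q₂ = (c₂ ^ 2) • (1 : Matrix (Fin s) (Fin s) ℝ) ∧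
          Q₁ᵀ * Q₂ = (c₁ * c₂) • (1 : Matrix (Fin s) (Fin s) ℝ))) ∧
    (∀ R₁ R₂ : Matrix (Fin d) (Fin d) ℝ,
      ((∀ u v : EuclideanSpace ℝ (Fin d), u ≠ 0 → v ≠ 0 →
          Matrix.toEuclideanLin R₁ u ≠ 0 ∧ Matrix.toEuclideanLin R₂ v ≠ 0 ∧
          angVec (Matrix.toEuclideanLin R₁ u) (Matrix.toEuclideanLin R₂ v) = angVec u v)
        ↔ (∃ c₁ c₂ : ℝ, c₁ ≠ 0 ∧ c₂ ≠ 0 ∧ ∃ Q : Matrix (Fin d) (Fin d) ℝ,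
            Qᵀ * Q = 1 ∧ R₁ = c₁ • Q ∧ R₂ = c₂ • Q))) := by
  refine ⟨part1 d s Q₁ Q₂, fun R₁ R₂ => ?_⟩
  rw [part1]
  constructor
  · rintro ⟨c₁, c₂, h1, h2, hA, hB, hAB⟩
    have hQ : (c₁⁻¹ • R₁)ᵀ * (c₁⁻¹ • R₁) = 1 := by
      rw [Matrix.transpose_smul, Matrix.smul_mul, Matrix.mul_smul, hA, smul_smul, smul_smul]
      convert one_smul ℝ _
      field_simp
    refine ⟨c₁, c₂, h1, h2, c₁⁻¹ • R₁, hQ, ?_, ?_⟩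
    · rw [smul_smul, mul_inv_cancel₀ h1, one_smul]
    · have h3 : (c₁⁻¹ • R₁)ᵀ * R₂ = c₂ • 1 := by
        rw [Matrix.transpose_smul, Matrix.smul_mul, hAB, smul_smul, inv_mul_cancel_left₀ h1]
      have h4 := mul_eq_one_comm.mp hQ
      calc R₂ = (c₁⁻¹ • R₁) * ((c₁⁻¹ • R₁)ᵀ * R₂) := by rw [← Matrix.mul_assoc, h4, Matrix.one_mul]
        _ = _ := by rw [h3, Matrix.mul_smul, Matrix.mul_one]
  · rintro ⟨c₁, c₂, h1, h2, Q, hQ, rfl, rfl⟩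
    refine ⟨c₁, c₂, h1, h2, ?_, ?_, ?_⟩ <;>
      rw [Matrix.transpose_smul, Matrix.smul_mul, Matrix.mul_smul, hQ, smul_smul] <;> ring_nf
end

section
/- For any two vectors v, w ∈ ℝ^d with ‖v‖ < ‖w‖ one has tan²( ∠(v+w, w) ) ≤ ‖v‖² / (‖w‖² − ‖v‖²), where ∠(v+w, w) is the principal angle between span(v+w) and span(w). -/
open scoped RealInnerProductSpace

/-- For any two vectors `v, w ∈ ℝ^d` with `‖v‖ < ‖w‖` one has
`tan²(∠(v+w, w)) ≤ ‖v‖²/(‖w‖² − ‖v‖²)`. -/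
theorem stmt5 (d : ℕ) (v w : EuclideanSpace ℝ (Fin d)) (h : ‖v‖ < ‖w‖) :
    Real.tan (angVec (v + w) w) ^ 2 ≤ ‖v‖ ^ 2 / (‖w‖ ^ 2 - ‖v‖ ^ 2) := by
  have hb : 0 < ‖w‖ := lt_of_le_of_lt (norm_nonneg v) h
  have hs : |⟪v, w⟫| ≤ ‖v‖ * ‖w‖ := abs_real_inner_le_norm v w
  have hs' := (abs_le.mp hs).1
  have hin : ⟪v + w, w⟫ = ⟪v, w⟫ + ‖w‖ ^ 2 := by
    rw [inner_add_left, real_inner_self_eq_norm_sq]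
  have hn : ‖v + w‖ ^ 2 = ‖v‖ ^ 2 + 2 * ⟪v, w⟫ + ‖w‖ ^ 2 := norm_add_sq_real v w
  have hipos : 0 < ⟪v + w, w⟫ := by
    rw [hin]; nlinarith
  have hle : |⟪v + w, w⟫| ≤ ‖v + w‖ * ‖w‖ := abs_real_inner_le_norm _ _
  have hnpos : 0 < ‖v + w‖ := by
    have h1 : 0 < ‖v + w‖ * ‖w‖ := lt_of_lt_of_le (abs_pos.mpr hipos.ne') hle
    exact pos_of_mul_pos_left h1 hb.le
  have hgap : 0 < ‖w‖ ^ 2 - ‖v‖ ^ 2 := by nlinarith [norm_nonneg v]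
  unfold angVec
  set x := |⟪v + w, w⟫| / (‖v + w‖ * ‖w‖) with hx
  have hxpos : 0 < x := div_pos (abs_pos.mpr hipos.ne') (mul_pos hnpos hb)
  have hx1 : x ≤ 1 := (div_le_one (mul_pos hnpos hb)).mpr hle
  have hxsq : x ^ 2 * (‖v + w‖ ^ 2 * ‖w‖ ^ 2) = (⟪v, w⟫ + ‖w‖ ^ 2) ^ 2 := by
    rw [hx, div_pow, sq_abs, hin]
    field_simp
  have key : ‖w‖ ^ 2 - ‖v‖ ^ 2 ≤ x ^ 2 * ‖w‖ ^ 2 := by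
    have hn2 : 0 < ‖v + w‖ ^ 2 := by positivity
    refine le_of_mul_le_mul_right ?_ hn2
    have : x ^ 2 * ‖w‖ ^ 2 * ‖v + w‖ ^ 2 = (⟪v, w⟫ + ‖w‖ ^ 2) ^ 2 := by
      rw [← hxsq]; ring
    rw [this, hn]
    nlinarith [sq_nonneg (⟪v, w⟫ + ‖v‖ ^ 2)]
  rw [Real.tan_arccos, div_pow, Real.sq_sqrt (by nlinarith), div_le_div_iff₀ (by positivity) hgap]
  nlinarith
end

section
/- Let k, c, m, s, d be integers with 0 ≤ c ≤ k, 0 ≤ m ≤ c, d = k + c, and 1 ≤ s ≤ d. Then there exist integers n₁, n₂ with 0 ≤ n₁ ≤ k − c, 0 ≤ n₂ ≤ c − m and s = m + n₁ + 2n₂ if and only if m ≤ min(s, d − s) and, in case c = k, the difference s − m is even. -/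
/-- Combinatorial characterization of admissible index sets: for integers
`k, c, m, s, d` with `0 ≤ c ≤ k`, `0 ≤ m ≤ c`, `d = k + c`, `1 ≤ s ≤ d`, there exist
`n₁, n₂` with `0 ≤ n₁ ≤ k − c`, `0 ≤ n₂ ≤ c − m` and `s = m + n₁ + 2n₂` iff
`m ≤ min(s, d − s)` and, in case `c = k`, `s − m` is even. -/
theorem stmt16 (k c m s d : ℤ)
    (hc0 : 0 ≤ c) (hck : c ≤ k) (hm0 : 0 ≤ m) (hmc : m ≤ c)
    (hd : d = k + c) (hs1 : 1 ≤ s) (hsd : s ≤ d) :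
    (∃ n₁ n₂ : ℤ, 0 ≤ n₁ ∧ n₁ ≤ k - c ∧ 0 ≤ n₂ ∧ n₂ ≤ c - m ∧ s = m + n₁ + 2 * n₂) ↔
      (m ≤ min s (d - s) ∧ (c = k → Even (s - m))) := by
  constructor
  · rintro ⟨n₁, n₂, h1, h2, h3, h4, h5⟩
    refine ⟨le_min (by omega) (by omega), fun h => ⟨n₂, by omega⟩⟩
  · rintro ⟨h, he⟩
    have ha := le_trans h (min_le_left _ _)
    have hb := le_trans h (min_le_right _ _)
    have he' : c = k → (s - m) % 2 = 0 := fun h => Int.even_iff.mp (he h)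
    clear he h
    by_cases hq : (s - m) / 2 ≤ c - m
    · refine ⟨(s - m) % 2, (s - m) / 2, by omega, ?_, by omega, hq, by omega⟩
      by_cases hk : c = k
      · have := he' hk
        omega
      · omega
    · exact ⟨s - m - 2 * (c - m), c - m, by omega, by omega, by omega, le_refl _, by omega⟩
end
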